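/- Let λ be a partition and ω a column-strict labelling of the Ferrers poset P_λ. Then E(P_λ, ω) is real-rooted. Moreover, if λ covers μ in Young's lattice (i.e. μ is a partition obtained from λ by removing a single box, so P_λ = P_μ ∪ {m} for a maximal element m), then E(P_μ, ω) ⪯ E(P_λ, ω), where ω also denotes the restricted labelling on P_μ. -/

import Mathlib

open Polynomial

/-- A real polynomial is real-rooted if it is nonzero and all of its complex zeros are real. -/
def RealRooted (f : Polynomial ℝ) : Prop :=
  f ≠ 0 ∧ ∀ z : ℂ, (f.map (algebraMap ℝ ℂ)).IsRoot z → z.im = 0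

/-- The zeros of `f`, listed in increasing order (with multiplicity). -/
noncomputable def sortedRoots (f : Polynomial ℝ) : List ℝ :=
  f.roots.sort (· ≤ ·)

/-- `g ⪯ f`: interlacing. Both are real-rooted, `deg f = deg g + 1`, and listing the zeros of
`f` as `α₁ ≤ ⋯ ≤ α_d` and of `g` as `β₁ ≤ ⋯ ≤ β_{d-1}` (with multiplicity, in increasing
order), one has `α₁ ≤ β₁ ≤ α₂ ≤ ⋯ ≤ β_{d-1} ≤ α_d`. -/
def Interlaces (g f : Polynomial ℝ) : Prop :=
  RealRooted f ∧ RealRooted g ∧ f.natDegree = g.natDegree + 1 ∧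
  ∀ i, i < g.natDegree →
    (sortedRoots f).getD i 0 ≤ (sortedRoots g).getD i 0 ∧
    (sortedRoots g).getD i 0 ≤ (sortedRoots f).getD (i + 1) 0

/-- `g ≺ f`: strict interlacing, where all the inequalities above are strict. -/
def StrictInterlaces (g f : Polynomial ℝ) : Prop :=
  RealRooted f ∧ RealRooted g ∧ f.natDegree = g.natDegree + 1 ∧
  ∀ i, i < g.natDegree →
    (sortedRoots f).getD i 0 < (sortedRoots g).getD i 0 ∧
    (sortedRoots g).getD i 0 < (sortedRoots f).getD (i + 1) 0

/-- `σ : P → {1,…,k}` (realised as `Fin k`) is a `(P,ω)`-partition if it is order reversing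
and `x < y` with `ω x > ω y` implies `σ x > σ y`. -/
def IsPPartition {α : Type*} [PartialOrder α] (ω : α → ℕ) {k : ℕ} (σ : α → Fin k) : Prop :=
  (∀ x y : α, x ≤ y → σ y ≤ σ x) ∧ (∀ x y : α, x < y → ω y < ω x → σ y < σ x)

/-- The `E`-polynomial `E(P,ω) = Σₖ e_k(P,ω) xᵏ`, where `e_k(P,ω)` is the number of
surjective `(P,ω)`-partitions `σ : P → {1,…,k}`. -/
noncomputable def Epoly (α : Type*) [PartialOrder α] (ω : α → ℕ) : Polynomial ℝ :=
  ∑ k ∈ Finset.range (Nat.card α + 1),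
    C ((Nat.card {σ : α → Fin k // Function.Surjective σ ∧ IsPPartition ω σ} : ℕ) : ℝ) * X ^ k

/-- The Ferrers poset of `λ : ℕ → ℕ` (the cell `(i,j)`, 0-indexed, is present when
`j < λ i`), with the componentwise product order inherited from `ℕ × ℕ`. -/
def FerrersPoset (lam : ℕ → ℕ) : Type := {p : ℕ × ℕ // p.2 < lam p.1}

instance (lam : ℕ → ℕ) : PartialOrder (FerrersPoset lam) :=
  inferInstanceAs (PartialOrder {p : ℕ × ℕ // p.2 < lam p.1})

/-- A labelling of a Ferrers poset is column strict if `ω(i,j) > ω(i+1,j)` and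
`ω(i,j) < ω(i,j+1)` whenever both cells are present. -/
def ColumnStrict (lam : ℕ → ℕ) (ω : FerrersPoset lam → ℕ) : Prop :=
  Function.Injective ω ∧
  (∀ p q : FerrersPoset lam,
    p.val.1 + 1 = q.val.1 → p.val.2 = q.val.2 → ω q < ω p) ∧
  (∀ p q : FerrersPoset lam,
    p.val.1 = q.val.1 → p.val.2 + 1 = q.val.2 → ω p < ω q)

/-! ### Counting roots and interlacing -/

/-- Counting form of interlacing: up to each level, `A` has as many elements as `B` or one more. -/
def CountInterlace (B A : Multiset ℝ) : Prop :=
  ∀ t : ℝ, B.countP (· ≤ t) ≤ A.countP (· ≤ t) ∧ A.countP (· ≤ t) ≤ B.countP (· ≤ t) + 1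

theorem CountInterlace.cons {A B : Multiset ℝ} (h : CountInterlace B A) (x : ℝ) :
    CountInterlace (x ::ₘ B) (x ::ₘ A) := by
  intro t
  have := h t
  simp only [Multiset.countP_cons]
  omega

theorem getD_le_iff_lt_countP {l : List ℝ} (hl : l.Pairwise (· ≤ ·)) (t : ℝ) :
    ∀ {i : ℕ}, i < l.length → (l.getD i 0 ≤ t ↔ i < l.countP (· ≤ t)) := by
  induction l with
  | nil => intro i hi; simp at hi
  | cons a l ih =>
    intro i hi
    rw [List.pairwise_cons] at hl
    by_cases hat : a ≤ t
    · cases i with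
      | zero => simp [hat]
      | succ i =>
        have := ih hl.2 (i := i) (by simpa using hi)
        simpa [List.countP_cons, hat] using this
    · have h0 : l.countP (· ≤ t) = 0 := by
        rw [List.countP_eq_zero]
        intro b hb
        have := hl.1 b hb
        simp only [decide_eq_true_eq]
        linarith
      have hle : a ≤ (a :: l).getD i 0 := by
        rw [List.getD_eq_getElem _ _ hi]
        rcases List.mem_cons.1 (List.getElem_mem hi) with h | h
        · exact h.ge
        · exact hl.1 _ h
      simp only [List.countP_cons, h0, hat, decide_false, Bool.false_eq_true, if_false]
      constructor
      · intro h; linarith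
      · intro h; omega

theorem CountInterlace.getD_sort {A B : Multiset ℝ} (h : CountInterlace B A)
    (hc : A.card = B.card + 1) {i : ℕ} (hi : i < B.card) :
    (A.sort (· ≤ ·)).getD i 0 ≤ (B.sort (· ≤ ·)).getD i 0 ∧
      (B.sort (· ≤ ·)).getD i 0 ≤ (A.sort (· ≤ ·)).getD (i + 1) 0 := by
  have key : ∀ (M : Multiset ℝ) (t : ℝ) (k : ℕ), k < M.card →
      ((M.sort (· ≤ ·)).getD k 0 ≤ t ↔ k < M.countP (· ≤ t)) := by
    intro M t k hk
    rw [getD_le_iff_lt_countP (M.pairwise_sort (· ≤ ·)) t (by simpa using hk)]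
    conv_rhs => rw [← Multiset.sort_eq M (· ≤ ·), Multiset.coe_countP]
  constructor
  · rw [key A _ i (by omega)]
    exact lt_of_lt_of_le ((key B _ i hi).1 le_rfl) (h _).1
  · rw [key B _ i hi]
    have h1 := (key A _ (i + 1) (by omega)).1 (le_refl ((A.sort (· ≤ ·)).getD (i + 1) 0))
    have h2 := (h ((A.sort (· ≤ ·)).getD (i + 1) 0)).2
    omega

theorem splits_of_forall_im_eq_zero {f : ℝ[X]}
    (hf : ∀ z : ℂ, (f.map (algebraMap ℝ ℂ)).IsRoot z → z.im = 0) : f.Splits := by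
  refine Splits.of_splits_map (algebraMap ℝ ℂ) (IsAlgClosed.splits _) ?_
  intro z hz
  refine ⟨z.re, ?_⟩
  apply Complex.ext
  · simp
  · simp [hf z (isRoot_of_mem_roots hz)]

theorem RealRooted.of_splits {f : ℝ[X]} (hf : f.Splits) (h0 : f ≠ 0) : RealRooted f := by
  refine ⟨h0, fun z hz => ?_⟩
  obtain ⟨x, rfl⟩ := hf.mem_range_of_isRoot h0 hz
  simp

theorem interlaces_of_countInterlace {f g : ℝ[X]} (hf : f.Splits) (hg : g.Splits) (hf0 : f ≠ 0)
    (hg0 : g ≠ 0) (hdeg : f.natDegree = g.natDegree + 1) (h : CountInterlace g.roots f.roots) :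
    Interlaces g f := by
  refine ⟨.of_splits hf hf0, .of_splits hg hg0, hdeg, fun i hi => ?_⟩
  rw [hf.natDegree_eq_card_roots, hg.natDegree_eq_card_roots] at hdeg
  exact h.getD_sort hdeg (by rwa [← hg.natDegree_eq_card_roots])

/-! ### Polynomials `F * (A x + B - ∑ wᵢ / (x - γᵢ))` -/

section Secular

variable {ι : Type*} [DecidableEq ι]

/-- The polynomial `(A x + B - ∑ wᵢ / (x - γᵢ)) * ∏ (x - γᵢ)`. -/
noncomputable def secularPoly (s : Finset ι) (γ w : ι → ℝ) (A B : ℝ) : ℝ[X] :=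
  (C A * X + C B) * ∏ i ∈ s, (X - C (γ i)) -
    ∑ i ∈ s, C (w i) * ∏ j ∈ s.erase i, (X - C (γ j))

theorem aeval_secularPoly {K : Type*} [Field K] [Algebra ℝ K] (s : Finset ι) (γ w : ι → ℝ)
    (A B : ℝ) {x : K} (hx : ∀ i ∈ s, x - algebraMap ℝ K (γ i) ≠ 0) :
    aeval x (secularPoly s γ w A B) = (∏ i ∈ s, (x - algebraMap ℝ K (γ i))) *
      (algebraMap ℝ K A * x + algebraMap ℝ K B -
        ∑ i ∈ s, algebraMap ℝ K (w i) / (x - algebraMap ℝ K (γ i))) := by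
  simp only [secularPoly, map_sub, map_mul, map_add, map_sum, map_prod, aeval_X, aeval_C]
  rw [mul_sub, mul_comm, Finset.mul_sum]
  congr 1
  refine Finset.sum_congr rfl fun i hi => ?_
  rw [← Finset.mul_prod_erase s _ hi]
  field_simp [hx i hi]

theorem eval_secularPoly (s : Finset ι) (γ w : ι → ℝ)
    (A B : ℝ) {x : ℝ} (hx : ∀ i ∈ s, x ≠ γ i) :
    (secularPoly s γ w A B).eval x = (∏ i ∈ s, (x - γ i)) *
      (A * x + B - ∑ i ∈ s, w i / (x - γ i)) := by
  have := aeval_secularPoly (K := ℝ) s γ w A B (x := x) fun i hi => sub_ne_zero.2 (hx i hi)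
  simpa [Polynomial.coe_aeval_eq_eval] using this

theorem eval_secularPoly_node {s : Finset ι} {γ : ι → ℝ} (w : ι → ℝ)
    (A B : ℝ) {i : ι} (hi : i ∈ s) :
    (secularPoly s γ w A B).eval (γ i) = - (w i * ∏ j ∈ s.erase i, (γ i - γ j)) := by
  simp only [secularPoly, eval_sub, eval_mul, eval_add, eval_finsetSum, eval_prod, eval_X, eval_C]
  rw [Finset.prod_eq_zero hi (sub_self _), mul_zero, zero_sub, Finset.sum_eq_single_of_mem i hi]
  intro j hj hji
  rw [Finset.prod_eq_zero (Finset.mem_erase.2 ⟨hji.symm, hi⟩) (sub_self _), mul_zero]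

theorem degree_secularPoly (s : Finset ι) (γ w : ι → ℝ) {A : ℝ} (B : ℝ) (hA : A ≠ 0) :
    (secularPoly s γ w A B).natDegree = s.card + 1 ∧ secularPoly s γ w A B ≠ 0 := by
  have h1 : ((C A * X + C B) * ∏ i ∈ s, (X - C (γ i)) : ℝ[X]).natDegree = s.card + 1 := by
    rw [natDegree_mul, natDegree_linear hA, natDegree_prod_of_monic _ _ fun i _ => monic_X_sub_C _]
    · simp [add_comm]
    · intro h
      have := natDegree_linear (b := B) hA
      simp [h] at this
    · exact (monic_prod_of_monic _ _ fun i _ => monic_X_sub_C _).ne_zero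
  have h2 : (∑ i ∈ s, C (w i) * ∏ j ∈ s.erase i, (X - C (γ j)) : ℝ[X]).natDegree ≤ s.card := by
    refine natDegree_sum_le_of_forall_le _ _ fun i hi => ?_
    refine (natDegree_C_mul_le _ _).trans ?_
    rw [natDegree_prod_of_monic _ _ fun i _ => monic_X_sub_C _]
    simpa using Finset.card_le_card (Finset.erase_subset i s)
  have h3 : (secularPoly s γ w A B).natDegree = s.card + 1 := by
    rw [secularPoly, natDegree_sub_eq_left_of_natDegree_lt (by omega), h1]
  refine ⟨h3, fun h => ?_⟩
  simp [h] at h3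

theorem secularPoly_of_weight_eq_zero {s : Finset ι} (γ w : ι → ℝ) (A B : ℝ) {i : ι} (hi : i ∈ s)
    (hw : w i = 0) :
    secularPoly s γ w A B = (X - C (γ i)) * secularPoly (s.erase i) γ w A B := by
  unfold secularPoly
  rw [← Finset.mul_prod_erase s _ hi, ← Finset.add_sum_erase s _ hi, hw, mul_sub, Finset.mul_sum]
  simp only [C_0, zero_mul, zero_add]
  rw [mul_left_comm]
  congr 1
  refine Finset.sum_congr rfl fun j hj => ?_
  have : i ∈ s.erase j := Finset.mem_erase.2 ⟨(Finset.ne_of_mem_erase hj).symm, hi⟩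
  rw [← Finset.mul_prod_erase (s.erase j) _ this, Finset.erase_right_comm]
  ring

theorem secularPoly_of_node_eq {s : Finset ι} {γ : ι → ℝ} (w : ι → ℝ) (A B : ℝ) {i k : ι}
    (hi : i ∈ s) (hk : k ∈ s) (hik : i ≠ k) (hγ : γ i = γ k) :
    secularPoly s γ w A B =
      (X - C (γ i)) * secularPoly (s.erase i) γ (Function.update w k (w i + w k)) A B := by
  have hk' : k ∈ s.erase i := Finset.mem_erase.2 ⟨hik.symm, hk⟩
  have hi' : i ∈ s.erase k := Finset.mem_erase.2 ⟨hik, hi⟩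
  unfold secularPoly
  rw [← Finset.mul_prod_erase s _ hi, ← Finset.add_sum_erase s _ hi, mul_sub,
    ← Finset.add_sum_erase _ _ hk', ← Finset.add_sum_erase _ _ hk', mul_add, Finset.mul_sum,
    mul_left_comm, Function.update_self, ← add_assoc]
  congr 2
  · rw [← Finset.mul_prod_erase (s.erase k) _ hi', ← Finset.mul_prod_erase (s.erase i) _ hk',
      Finset.erase_right_comm (a := k), hγ, C_add]
    ring
  · refine Finset.sum_congr rfl fun j hj => ?_
    have hjk : j ≠ k := Finset.ne_of_mem_erase hj
    have hji : j ≠ i := Finset.ne_of_mem_erase (Finset.mem_of_mem_erase hj)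
    have : i ∈ s.erase j := Finset.mem_erase.2 ⟨hji.symm, hi⟩
    rw [← Finset.mul_prod_erase (s.erase j) _ this, Finset.erase_right_comm,
      Function.update_of_ne hjk]
    ring

theorem splits_secularPoly {s : Finset ι} {γ w : ι → ℝ} {A : ℝ} (B : ℝ) (hA : 0 < A)
    (hw : ∀ i ∈ s, 0 ≤ w i) : (secularPoly s γ w A B).Splits := by
  apply splits_of_forall_im_eq_zero
  intro z hz
  by_contra him
  have hne : ∀ i ∈ s, z - algebraMap ℝ ℂ (γ i) ≠ 0 := by
    intro i _ h
    apply him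
    have := congrArg Complex.im h
    simpa using this
  rw [IsRoot.def, eval_map_algebraMap, aeval_secularPoly s γ w A B hne, mul_eq_zero,
    Finset.prod_eq_zero_iff] at hz
  rcases hz with ⟨i, hi, h⟩ | hz
  · exact hne i hi h
  · have h2 := congrArg Complex.im hz
    have h3 : ∀ i ∈ s, (algebraMap ℝ ℂ (w i) / (z - algebraMap ℝ ℂ (γ i))).im =
        - (w i / Complex.normSq (z - algebraMap ℝ ℂ (γ i))) * z.im := by
      intro i _
      simp [Complex.div_im]
      ring
    simp only [Complex.sub_im, Complex.add_im, Complex.im_sum, Complex.zero_im] at h2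
    rw [Finset.sum_congr rfl h3, ← Finset.sum_mul] at h2
    simp only [Complex.coe_algebraMap, Complex.mul_im, Complex.ofReal_re, Complex.ofReal_im,
      zero_mul, add_zero, Finset.sum_neg_distrib] at h2
    have h4 : 0 ≤ ∑ i ∈ s, w i / Complex.normSq (z - (γ i : ℂ)) :=
      Finset.sum_nonneg fun i hi => div_nonneg (hw i hi) (Complex.normSq_nonneg _)
    have h5 : (A + ∑ i ∈ s, w i / Complex.normSq (z - (γ i : ℂ))) * z.im = 0 := by
      linarith
    rcases mul_eq_zero.1 h5 with h | h
    · linarith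
    · exact him h

theorem nodup_roots_secularPoly {s : Finset ι} {γ w : ι → ℝ} {A B : ℝ} (hA : 0 < A)
    (hw : ∀ i ∈ s, 0 ≤ w i) (hne : ∀ i ∈ s, (secularPoly s γ w A B).eval (γ i) ≠ 0) :
    (secularPoly s γ w A B).roots.Nodup := by
  have h0 := (degree_secularPoly s γ w B hA.ne').2
  rw [Multiset.nodup_iff_count_le_one]
  intro x
  rw [count_roots]
  by_contra! hx
  obtain ⟨hx0, hx1⟩ := (one_lt_rootMultiplicity_iff_isRoot h0).1 hx
  have hxs : ∀ i ∈ s, x ≠ γ i := fun i hi h => hne i hi (h ▸ hx0)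
  have hprod : ∏ i ∈ s, (x - γ i) ≠ 0 :=
    Finset.prod_ne_zero_iff.2 fun i hi => sub_ne_zero.2 (hxs i hi)
  have hev : ∀ᶠ y in nhds x, ∀ i ∈ s, y ≠ γ i :=
    (Filter.eventually_all_finset s).2 fun i hi => isOpen_ne.mem_nhds (hxs i hi)
  have hRx : A * x + B - ∑ i ∈ s, w i / (x - γ i) = 0 := by
    have := eval_secularPoly s γ w A B hxs
    rw [hx0] at this
    exact (mul_eq_zero.1 this.symm).resolve_left hprod
  have hR : HasDerivAt (fun y => A * y + B - ∑ i ∈ s, w i / (y - γ i))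
      (A - ∑ i ∈ s, -(w i / (x - γ i) ^ 2)) x := by
    refine HasDerivAt.sub ?_ (HasDerivAt.fun_sum fun i hi => ?_)
    · simpa using ((hasDerivAt_id x).const_mul A).add_const B
    · have := ((hasDerivAt_id x).sub_const (γ i)).fun_inv (sub_ne_zero.2 (hxs i hi))
      have := this.const_mul (w i)
      simpa [div_eq_mul_inv] using this
  have hF : HasDerivAt (fun y => ∏ i ∈ s, (y - γ i))
      ((∏ i ∈ s, (X - C (γ i)) : ℝ[X]).derivative.eval x) x := by
    have h := (∏ i ∈ s, (X - C (γ i)) : ℝ[X]).hasDerivAt x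
    simp only [eval_prod, eval_sub, eval_X, eval_C] at h
    exact h
  have hQ := ((secularPoly s γ w A B).hasDerivAt x).congr_of_eventuallyEq
    (f₁ := fun y => (∏ i ∈ s, (y - γ i)) * (A * y + B - ∑ i ∈ s, w i / (y - γ i)))
    (hev.mono fun y hy => (eval_secularPoly s γ w A B hy).symm)
  have huniq := hQ.unique (hF.mul hR)
  rw [hx1, hRx, mul_zero, zero_add] at huniq
  have hpos : 0 < A - ∑ i ∈ s, -(w i / (x - γ i) ^ 2) := by
    rw [Finset.sum_neg_distrib, sub_neg_eq_add]
    have := Finset.sum_nonneg fun i hi => div_nonneg (hw i hi) (sq_nonneg (x - γ i))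
    linarith
  exact mul_ne_zero hprod hpos.ne' huniq.symm

theorem exists_node_between {s : Finset ι} {γ w : ι → ℝ} {A B : ℝ} (hA : 0 < A)
    (hw : ∀ i ∈ s, 0 ≤ w i) (hne : ∀ i ∈ s, (secularPoly s γ w A B).eval (γ i) ≠ 0) {x y : ℝ}
    (hxy : x < y) (hx : (secularPoly s γ w A B).eval x = 0)
    (hy : (secularPoly s γ w A B).eval y = 0) : ∃ i ∈ s, x < γ i ∧ γ i < y := by
  by_contra! hcon
  have hxs : ∀ i ∈ s, x ≠ γ i := fun i hi h => hne i hi (h ▸ hx)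
  have hys : ∀ i ∈ s, y ≠ γ i := fun i hi h => hne i hi (h ▸ hy)
  rw [eval_secularPoly s γ w A B hxs, mul_eq_zero, or_iff_right
    (Finset.prod_ne_zero_iff.2 fun i hi => sub_ne_zero.2 (hxs i hi))] at hx
  rw [eval_secularPoly s γ w A B hys, mul_eq_zero, or_iff_right
    (Finset.prod_ne_zero_iff.2 fun i hi => sub_ne_zero.2 (hys i hi))] at hy
  have : ∑ i ∈ s, w i / (y - γ i) ≤ ∑ i ∈ s, w i / (x - γ i) := by
    refine Finset.sum_le_sum fun i hi => ?_
    have hwi := hw i hi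
    rcases lt_or_gt_of_ne (hxs i hi) with h | h
    · have h2 : y < γ i := lt_of_le_of_ne (hcon i hi h) (hys i hi)
      have e : ∀ u : ℝ, w i / (u - γ i) = - (w i / (γ i - u)) := by
        intro u
        rw [← neg_sub (γ i) u, div_neg]
      rw [e, e]
      exact neg_le_neg (div_le_div_of_nonneg_left hwi (by linarith) (by linarith))
    · exact div_le_div_of_nonneg_left hwi (by linarith) (by linarith)
  nlinarith

theorem countInterlace_secularPoly_of_injOn {s : Finset ι} {γ w : ι → ℝ} {A : ℝ} (B : ℝ)
    (hA : 0 < A) (hw : ∀ i ∈ s, 0 < w i) (hγ : Set.InjOn γ s) :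
    CountInterlace (s.val.map γ) (secularPoly s γ w A B).roots := by
  have hw' : ∀ i ∈ s, 0 ≤ w i := fun i hi => (hw i hi).le
  have h0 := (degree_secularPoly s γ w B hA.ne').2
  have hne : ∀ i ∈ s, (secularPoly s γ w A B).eval (γ i) ≠ 0 := by
    intro i hi
    rw [eval_secularPoly_node w A B hi]
    refine neg_ne_zero.2 (mul_ne_zero (hw i hi).ne' (Finset.prod_ne_zero_iff.2 fun j hj => ?_))
    exact sub_ne_zero.2 fun h => Finset.ne_of_mem_erase hj
      (hγ (Finset.mem_of_mem_erase hj) hi h.symm)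
  have hnd := nodup_roots_secularPoly hA hw' hne
  have hcard : (secularPoly s γ w A B).roots.card = s.card + 1 := by
    rw [← (splits_secularPoly B hA hw').natDegree_eq_card_roots,
      (degree_secularPoly s γ w B hA.ne').1]
  have hbound : ∀ p : ℝ → Prop, ∀ _ : DecidablePred p,
      (∀ x y z, p x → p y → x < z → z < y → p z) →
      (secularPoly s γ w A B).roots.countP p ≤ (s.val.map γ).countP p + 1 := by
    intro p _ hp
    have e1 : (secularPoly s γ w A B).roots.countP p =
        ((secularPoly s γ w A B).roots.toFinset.filter p).card := by
      rw [Multiset.countP_eq_card_filter, Finset.card_def, Finset.filter_val,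
        Multiset.toFinset_val, hnd.dedup]
    have e2 : (s.val.map γ).countP p = ((s.image γ).filter p).card := by
      rw [Multiset.countP_eq_card_filter, Finset.card_def, Finset.filter_val,
        Finset.image_val_of_injOn hγ]
    rw [e1, e2]
    apply Finset.card_le_of_interleaved
    intro x hx y hy hxy _
    simp only [Finset.mem_filter, Multiset.mem_toFinset, mem_roots h0, IsRoot.def] at hx hy
    obtain ⟨i, hi, h1, h2⟩ := exists_node_between hA hw' hne hxy hx.1 hy.1
    refine ⟨γ i, ?_, h1, h2⟩
    simp only [Finset.mem_filter]
    exact ⟨Finset.mem_image_of_mem _ hi, hp x y _ hx.2 hy.2 h1 h2⟩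
  intro t
  have h1 := hbound (· ≤ t) inferInstance fun x y z _ hy _ hz => hz.le.trans hy
  have h2 := hbound (fun a => ¬ a ≤ t) inferInstance fun x y z hx _ hz _ => by
    push Not at hx ⊢
    exact hx.trans hz
  have h3 := Multiset.card_eq_countP_add_countP (· ≤ t) (secularPoly s γ w A B).roots
  have h4 := Multiset.card_eq_countP_add_countP (· ≤ t) (s.val.map γ)
  rw [Multiset.card_map, Finset.card_val] at h4
  omega

theorem countInterlace_secularPoly {γ : ι → ℝ} {A : ℝ} (B : ℝ) (hA : 0 < A) (s : Finset ι) :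
    ∀ w : ι → ℝ, (∀ i ∈ s, 0 ≤ w i) →
      CountInterlace (s.val.map γ) (secularPoly s γ w A B).roots := by
  induction s using Finset.strongInduction with
  | H s ih =>
    intro w hw
    have hmap : ∀ i ∈ s, s.val.map γ = γ i ::ₘ (s.erase i).val.map γ := by
      intro i hi
      rw [← Multiset.map_cons, Finset.erase_val, Multiset.cons_erase hi]
    have hroots : ∀ (i : ι) (q : ℝ[X]), q ≠ 0 →
        ((X - C (γ i)) * q).roots = γ i ::ₘ q.roots := by
      intro i q hq
      rw [roots_mul (mul_ne_zero (X_sub_C_ne_zero _) hq), roots_X_sub_C, Multiset.singleton_add]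
    by_cases h1 : ∃ i ∈ s, w i = 0
    · obtain ⟨i, hi, hwi⟩ := h1
      rw [secularPoly_of_weight_eq_zero γ w A B hi hwi, hmap i hi,
        hroots _ _ (degree_secularPoly _ γ w B hA.ne').2]
      exact (ih _ (Finset.erase_ssubset hi) w fun j hj => hw j (Finset.mem_of_mem_erase hj)).cons _
    by_cases h2 : Set.InjOn γ s
    · push Not at h1
      exact countInterlace_secularPoly_of_injOn B hA
        (fun i hi => lt_of_le_of_ne (hw i hi) (h1 i hi).symm) h2
    · simp only [Set.InjOn, not_forall] at h2
      obtain ⟨i, hi, k, hk, hik, hne⟩ := h2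
      rw [secularPoly_of_node_eq w A B hi hk hne hik, hmap i hi,
        hroots _ _ (degree_secularPoly _ γ _ B hA.ne').2]
      refine (ih _ (Finset.erase_ssubset hi) _ fun j hj => ?_).cons _
      rcases eq_or_ne j k with rfl | hjk
      · rw [Function.update_self]
        exact add_nonneg (hw i hi) (hw j hk)
      · rw [Function.update_of_ne hjk]
        exact hw j (Finset.mem_of_mem_erase hj)

end Secular

/-! ### The operator corresponding to multiplication by `x + c` -/

/-- The operator `F ↦ x (x + 1) F' + (x + c) F`. In the basis transform `binom(x, k) ↦ x ^ k` it
corresponds to multiplication by `x + c`. -/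
noncomputable def contentOp (c : ℝ) (F : ℝ[X]) : ℝ[X] :=
  X * (X + 1) * derivative F + (X + C c) * F

theorem contentOp_C_mul (c a : ℝ) (F : ℝ[X]) : contentOp c (C a * F) = C a * contentOp c F := by
  simp only [contentOp, derivative_C_mul]
  ring

theorem contentOp_prod {ι : Type*} [DecidableEq ι] (c : ℝ) (s : Finset ι) (γ : ι → ℝ) :
    contentOp c (∏ i ∈ s, (X - C (γ i))) =
      secularPoly s γ (fun i => - (γ i * (γ i + 1))) (s.card + 1) (c + ∑ i ∈ s, (1 + γ i)) := by
  have h : ∀ i ∈ s, X * (X + 1) * ((∏ j ∈ s.erase i, (X - C (γ j))) * derivative (X - C (γ i))) =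
      (X + C (1 + γ i)) * ∏ j ∈ s, (X - C (γ j)) -
        C (- (γ i * (γ i + 1))) * ∏ j ∈ s.erase i, (X - C (γ j)) := by
    intro i hi
    rw [← Finset.mul_prod_erase s _ hi]
    simp only [derivative_sub, derivative_X, derivative_C, C_add, C_neg, C_mul, C_1]
    ring
  rw [contentOp, secularPoly, derivative_prod_finset, Finset.mul_sum, Finset.sum_congr rfl h,
    Finset.sum_sub_distrib, ← Finset.sum_mul, Finset.sum_add_distrib, Finset.sum_const]
  simp only [C_add, map_sum, C_1, nsmul_eq_mul, map_natCast]
  ring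

theorem contentOp_interlace {F : ℝ[X]} (hF : F.Splits) (hF0 : F ≠ 0)
    (hroots : ∀ r ∈ F.roots, -1 ≤ r ∧ r ≤ 0) (c : ℝ) :
    (contentOp c F).Splits ∧ contentOp c F ≠ 0 ∧ (contentOp c F).natDegree = F.natDegree + 1 ∧
      CountInterlace F.roots (contentOp c F).roots := by
  classical
  obtain ⟨ι, _, γ, hmap⟩ : ∃ (ι : Type) (_ : Fintype ι) (γ : ι → ℝ),
      (Finset.univ : Finset ι).val.map γ = F.roots :=
    ⟨F.roots.ToType, inferInstance, _, Multiset.map_univ_coe F.roots⟩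
  have hprod : F = C F.leadingCoeff * ∏ i, (X - C (γ i)) := by
    conv_lhs => rw [hF.eq_prod_roots]
    rw [← hmap, Multiset.map_map]
    rfl
  have hcard : (Finset.univ : Finset ι).card = F.natDegree := by
    rw [hF.natDegree_eq_card_roots, ← hmap, Multiset.card_map, Finset.card_def]
  have hlc : F.leadingCoeff ≠ 0 := leadingCoeff_ne_zero.2 hF0
  have hA : (0 : ℝ) < ((Finset.univ : Finset ι).card : ℝ) + 1 := Nat.cast_add_one_pos _
  have hw : ∀ i ∈ (Finset.univ : Finset ι), 0 ≤ - (γ i * (γ i + 1)) := by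
    intro i _
    have := hroots (γ i) (hmap ▸ Multiset.mem_map_of_mem γ (Finset.mem_univ_val i))
    nlinarith
  have hQ : contentOp c F = C F.leadingCoeff * secularPoly Finset.univ γ
      (fun i => - (γ i * (γ i + 1))) ((Finset.univ : Finset ι).card + 1)
      (c + ∑ i, (1 + γ i)) := by
    rw [← contentOp_prod, ← contentOp_C_mul, ← hprod]
  have hdeg := degree_secularPoly Finset.univ γ (fun i => - (γ i * (γ i + 1)))
    (c + ∑ i, (1 + γ i)) hA.ne'
  rw [hQ]
  refine ⟨(Splits.C _).mul (splits_secularPoly _ hA hw), mul_ne_zero (C_ne_zero.2 hlc) hdeg.2, ?_,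
    ?_⟩
  · rw [natDegree_C_mul hlc, hdeg.1, hcard]
  · rw [roots_C_mul _ hlc]
    rw [← hmap]
    exact countInterlace_secularPoly _ hA _ _ hw

theorem contentOp_X_pow_mul (c : ℝ) (a : ℕ) (H : ℝ[X]) :
    contentOp c (X ^ a * H) =
      X ^ a * (X * (X + 1) * derivative H + (C (a : ℝ) * (X + 1) + X + C c) * H) := by
  have h : (X : ℝ[X]) * derivative (X ^ a : ℝ[X]) = C (a : ℝ) * X ^ a := by
    cases a with
    | zero => simp
    | succ a =>
      rw [derivative_X_pow, Nat.add_sub_cancel]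
      ring
  rw [contentOp, derivative_mul]
  linear_combination ((X + 1) * H) * h

theorem contentOp_X_add_one_pow_mul (c : ℝ) (b : ℕ) (H : ℝ[X]) :
    contentOp c ((X + 1) ^ b * H) =
      (X + 1) ^ b * (X * (X + 1) * derivative H + (C (b : ℝ) * X + X + C c) * H) := by
  have h : (X + 1 : ℝ[X]) * derivative ((X + 1) ^ b : ℝ[X]) = C (b : ℝ) * (X + 1) ^ b := by
    cases b with
    | zero => simp
    | succ b =>
      rw [derivative_pow, Nat.add_sub_cancel]
      simp only [derivative_add, derivative_X, derivative_one]
      ring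
  rw [contentOp, derivative_mul]
  linear_combination (X * H) * h

theorem X_pow_dvd_contentOp {F : ℝ[X]} (c : ℝ) {a : ℕ} (h : X ^ a ∣ F) :
    X ^ a ∣ contentOp c F := by
  obtain ⟨H, rfl⟩ := h
  exact ⟨_, contentOp_X_pow_mul c a H⟩

theorem X_pow_succ_dvd_contentOp {F : ℝ[X]} {a : ℕ} (h : X ^ a ∣ F) :
    X ^ (a + 1) ∣ contentOp (-a) F := by
  obtain ⟨H, rfl⟩ := h
  refine ⟨(X + 1) * derivative H + (C (a : ℝ) + 1) * H, ?_⟩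
  rw [contentOp_X_pow_mul, C_neg]
  ring

theorem X_add_one_pow_dvd_contentOp {F : ℝ[X]} (c : ℝ) {b : ℕ} (h : (X + 1) ^ b ∣ F) :
    (X + 1) ^ b ∣ contentOp c F := by
  obtain ⟨H, rfl⟩ := h
  exact ⟨_, contentOp_X_add_one_pow_mul c b H⟩

theorem X_add_one_pow_succ_dvd_contentOp {F : ℝ[X]} {b : ℕ} (h : (X + 1) ^ b ∣ F) :
    (X + 1) ^ (b + 1) ∣ contentOp (b + 1) F := by
  obtain ⟨H, rfl⟩ := h
  refine ⟨X * derivative H + (C (b : ℝ) + 1) * H, ?_⟩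
  rw [contentOp_X_add_one_pow_mul, C_add, C_1]
  ring

theorem roots_contentOp_nonpos {F : ℝ[X]} (hF : F.Splits) (hF0 : F ≠ 0)
    (hroots : ∀ r ∈ F.roots, r ≤ 0) {a : ℕ} (ha : X ^ a ∣ F) {c : ℝ} (hc : 0 ≤ a + c) :
    ∀ r ∈ (contentOp c F).roots, r ≤ 0 := by
  intro x hx
  by_contra! hpos
  obtain ⟨H, rfl⟩ := ha
  have hH0 : H ≠ 0 := right_ne_zero_of_mul hF0
  have hH : H.Splits := hF.of_dvd hF0 (dvd_mul_left _ _)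
  have hHr : ∀ r ∈ H.roots, r ≤ 0 := fun r hr =>
    hroots r (Multiset.mem_of_le (roots.le_of_dvd hF0 (dvd_mul_left _ _)) hr)
  have hHx : H.eval x ≠ 0 := fun h => (hHr x ((mem_roots hH0).2 h)).not_gt hpos
  have hev := isRoot_of_mem_roots hx
  rw [contentOp_X_pow_mul, IsRoot.def] at hev
  simp only [eval_mul, eval_pow, eval_X, eval_add, eval_one, eval_C] at hev
  rw [hH.eval_derivative_eq_eval_mul_sum hHx] at hev
  have hS : 0 ≤ (H.roots.map fun z ↦ 1 / (x - z)).sum := by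
    refine Multiset.sum_nonneg fun y hy => ?_
    obtain ⟨z, hz, rfl⟩ := Multiset.mem_map.1 hy
    have := hHr z hz
    exact div_nonneg zero_le_one (by linarith)
  set S := (H.roots.map fun z ↦ 1 / (x - z)).sum
  have hfac : x ^ a * H.eval x * (x * (x + 1) * S + (a * (x + 1) + x + c)) = 0 := by
    linear_combination hev
  refine mul_ne_zero (mul_ne_zero (pow_ne_zero a hpos.ne') hHx) (ne_of_gt ?_) hfac
  have h1 : 0 ≤ x * (x + 1) * S := by positivity
  have h2 : 0 ≤ (a : ℝ) * x := by positivity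
  nlinarith

theorem neg_one_le_roots_contentOp {F : ℝ[X]} (hF : F.Splits) (hF0 : F ≠ 0)
    (hroots : ∀ r ∈ F.roots, -1 ≤ r) {b : ℕ} (hb : (X + 1) ^ b ∣ F) {c : ℝ} (hc : c ≤ b + 1) :
    ∀ r ∈ (contentOp c F).roots, -1 ≤ r := by
  intro x hx
  by_contra! hneg
  obtain ⟨H, rfl⟩ := hb
  have hH0 : H ≠ 0 := right_ne_zero_of_mul hF0
  have hH : H.Splits := hF.of_dvd hF0 (dvd_mul_left _ _)
  have hHr : ∀ r ∈ H.roots, -1 ≤ r := fun r hr =>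
    hroots r (Multiset.mem_of_le (roots.le_of_dvd hF0 (dvd_mul_left _ _)) hr)
  have hHx : H.eval x ≠ 0 := fun h => (hHr x ((mem_roots hH0).2 h)).not_gt hneg
  have hev := isRoot_of_mem_roots hx
  rw [contentOp_X_add_one_pow_mul, IsRoot.def] at hev
  simp only [eval_mul, eval_pow, eval_X, eval_add, eval_one, eval_C] at hev
  rw [hH.eval_derivative_eq_eval_mul_sum hHx] at hev
  have hS : 0 ≤ (H.roots.map fun z ↦ - (1 / (x - z))).sum := by
    refine Multiset.sum_nonneg fun y hy => ?_
    obtain ⟨z, hz, rfl⟩ := Multiset.mem_map.1 hy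
    have := hHr z hz
    exact neg_nonneg.2 (div_nonpos_of_nonneg_of_nonpos zero_le_one (by linarith))
  rw [Multiset.sum_map_neg, neg_nonneg] at hS
  set S := (H.roots.map fun z ↦ 1 / (x - z)).sum
  have hfac : (x + 1) ^ b * H.eval x * (x * (x + 1) * S + (b * x + x + c)) = 0 := by
    linear_combination hev
  refine mul_ne_zero (mul_ne_zero (pow_ne_zero b (by linarith)) hHx) (ne_of_lt ?_) hfac
  have h1 : x * (x + 1) * S ≤ 0 := mul_nonpos_of_nonneg_of_nonpos (by nlinarith) hS
  have h2 : (b : ℝ) * (x + 1) ≤ 0 := mul_nonpos_of_nonneg_of_nonpos (by positivity) (by linarith)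
  nlinarith

/-! ### The order polynomial in terms of surjective `(P, ω)`-partitions -/

theorem isPPartition_comp_iff {α : Type*} [PartialOrder α] (ω : α → ℕ) {k n : ℕ}
    (e : Fin k ↪o Fin n) (τ : α → Fin k) :
    IsPPartition ω (fun a => e (τ a)) ↔ IsPPartition ω τ := by
  simp only [IsPPartition, e.le_iff_le, e.lt_iff_lt]

theorem card_isPPartition_eq_sum_finset {α : Type*} [PartialOrder α] [Finite α] (ω : α → ℕ)
    (n : ℕ) :
    Nat.card {σ : α → Fin n // IsPPartition ω σ} =
      ∑ S : Finset (Fin n),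
        Nat.card {σ : α → Fin S.card // Function.Surjective σ ∧ IsPPartition ω σ} := by
  classical
  cases nonempty_fintype α
  rw [← Nat.card_sigma]
  symm
  refine Nat.card_congr (Equiv.ofBijective
    (fun x => ⟨fun a => x.1.orderEmbOfFin rfl (x.2.1 a),
      (isPPartition_comp_iff ω _ _).2 x.2.2.2⟩) ⟨?_, ?_⟩)
  · rintro ⟨S, τ, hτ, _⟩ ⟨S', τ', hτ', _⟩ h
    have h' : ∀ a, S.orderEmbOfFin rfl (τ a) = S'.orderEmbOfFin rfl (τ' a) :=
      fun a => congrFun (congrArg Subtype.val h) a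
    have hrange : ∀ (R : Finset (Fin n)) (ρ : α → Fin R.card), Function.Surjective ρ →
        ∀ x, x ∈ R ↔ ∃ a, R.orderEmbOfFin rfl (ρ a) = x := by
      intro R ρ hρ x
      have hx : x ∈ R ↔ x ∈ Set.range (R.orderEmbOfFin rfl) := by
        rw [Finset.range_orderEmbOfFin, Finset.mem_coe]
      rw [hx, Set.mem_range, hρ.exists]
    obtain rfl : S = S' := by
      ext x
      rw [hrange S τ hτ, hrange S' τ' hτ']
      simp only [h']
    obtain rfl : τ = τ' := funext fun a => (S.orderEmbOfFin rfl).injective (h' a)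
    rfl
  · rintro ⟨σ, hσ⟩
    set S : Finset (Fin n) := Finset.univ.image σ
    have hmem : ∀ a, σ a ∈ S := fun a => Finset.mem_image_of_mem σ (Finset.mem_univ a)
    set τ : α → Fin S.card := fun a => (S.orderIsoOfFin rfl).symm ⟨σ a, hmem a⟩ with hτdef
    have hτ : ∀ a, S.orderEmbOfFin rfl (τ a) = σ a := by
      intro a
      rw [← Finset.coe_orderIsoOfFin_apply, hτdef]
      simp
    refine ⟨⟨S, τ, ?_, ?_⟩, ?_⟩
    · intro k
      obtain ⟨a, -, ha⟩ := Finset.mem_image.1 (S.orderEmbOfFin_mem rfl k)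
      exact ⟨a, (S.orderEmbOfFin rfl).injective ((hτ a).trans ha)⟩
    · rw [← isPPartition_comp_iff ω (S.orderEmbOfFin rfl)]
      simpa only [hτ] using hσ
    · exact Subtype.ext (funext hτ)

theorem card_isPPartition {α : Type*} [PartialOrder α] [Finite α] (ω : α → ℕ) (n : ℕ) :
    Nat.card {σ : α → Fin n // IsPPartition ω σ} =
      ∑ k ∈ Finset.range (Nat.card α + 1),
        Nat.card {σ : α → Fin k // Function.Surjective σ ∧ IsPPartition ω σ} * n.choose k := by
  have hzero : ∀ k, Nat.card α < k →
      Nat.card {σ : α → Fin k // Function.Surjective σ ∧ IsPPartition ω σ} = 0 := by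
    intro k hk
    have : IsEmpty {σ : α → Fin k // Function.Surjective σ ∧ IsPPartition ω σ} := by
      refine ⟨fun σ => ?_⟩
      have := Nat.card_le_card_of_surjective σ.1 σ.2.1
      rw [Nat.card_fin] at this
      omega
    exact Nat.card_of_isEmpty
  rw [card_isPPartition_eq_sum_finset, ← Finset.powerset_univ,
    Finset.sum_powerset_apply_card
      (fun k => Nat.card {σ : α → Fin k // Function.Surjective σ ∧ IsPPartition ω σ})]
  simp only [Finset.card_univ, Fintype.card_fin, smul_eq_mul, mul_comm (n.choose _)]
  rw [Finset.sum_subset (Finset.range_mono (show n + 1 ≤ n + Nat.card α + 1 by omega)),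
    Finset.sum_subset (Finset.range_mono (show Nat.card α + 1 ≤ n + Nat.card α + 1 by omega))]
  · intro k _ hk
    rw [hzero k (by simpa [Nat.lt_succ_iff] using hk), zero_mul]
  · intro k _ hk
    rw [Nat.choose_eq_zero_of_lt (by simpa [Nat.lt_succ_iff] using hk), mul_zero]

/-- The linear functional `x ^ k ↦ binom(n, k)`. -/
noncomputable def binomEval (n : ℕ) : ℝ[X] →ₗ[ℝ] ℝ :=
  Polynomial.lsum fun k => (n.choose k : ℝ) • LinearMap.id

theorem binomEval_C_mul_X_pow (n k : ℕ) (a : ℝ) : binomEval n (C a * X ^ k) = a * n.choose k := by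
  rw [binomEval, lsum_apply, C_mul_X_pow_eq_monomial, sum_monomial_index _ _ (by simp),
    LinearMap.smul_apply, LinearMap.id_apply, smul_eq_mul, mul_comm]

theorem binomEval_eq_sum (n : ℕ) (p : ℝ[X]) :
    binomEval n p = ∑ k ∈ Finset.range (p.natDegree + 1), p.coeff k * n.choose k := by
  conv_lhs => rw [p.as_sum_range_C_mul_X_pow]
  simp only [map_sum, binomEval_C_mul_X_pow]

theorem binomEval_Epoly {α : Type*} [PartialOrder α] [Finite α] (ω : α → ℕ) (n : ℕ) :
    binomEval n (Epoly α ω) = Nat.card {σ : α → Fin n // IsPPartition ω σ} := by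
  rw [card_isPPartition, Epoly]
  simp only [map_sum, binomEval_C_mul_X_pow]
  push_cast
  rfl

theorem binomEval_contentOp (n : ℕ) (c : ℝ) (p : ℝ[X]) :
    binomEval n (contentOp c p) = (n + c) * binomEval n p := by
  induction p using Polynomial.induction_on' with
  | add p q hp hq =>
    have : contentOp c (p + q) = contentOp c p + contentOp c q := by
      simp only [contentOp, derivative_add]
      ring
    rw [this, map_add, hp, hq, map_add, mul_add]
  | monomial k a =>
    have h : contentOp c (monomial k a) =
        C (a * (k + c)) * X ^ k + C (a * (k + 1)) * X ^ (k + 1) := by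
      rw [← C_mul_X_pow_eq_monomial, contentOp_C_mul]
      have := contentOp_X_pow_mul c k 1
      rw [mul_one] at this
      rw [this]
      simp only [derivative_one, C_mul, C_add, C_1]
      ring
    rw [h, map_add, binomEval_C_mul_X_pow, binomEval_C_mul_X_pow, ← C_mul_X_pow_eq_monomial,
      binomEval_C_mul_X_pow]
    have h2 : (n : ℝ) * n.choose k = k * n.choose k + (k + 1) * n.choose (k + 1) := by
      have h3 := Nat.choose_succ_right_eq n k
      rcases le_total k n with hk | hk
      · have h4 : ((n.choose (k + 1) * (k + 1) : ℕ) : ℝ) = ((n.choose k * (n - k) : ℕ) : ℝ) := by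
          rw [h3]
        push_cast [Nat.cast_sub hk] at h4
        linear_combination -h4
      · have h4 : n.choose (k + 1) = 0 := Nat.choose_eq_zero_of_lt (by omega)
        rcases hk.eq_or_lt with rfl | hk
        · simp
        · simp [h4, Nat.choose_eq_zero_of_lt hk]
    linear_combination -a * h2

theorem eq_zero_of_binomEval_eq_zero {p : ℝ[X]} {N : ℕ} (h : ∀ n, N ≤ n → binomEval n p = 0) :
    p = 0 := by
  set q : ℝ[X] := ∑ k ∈ Finset.range (p.natDegree + 1),
    C (p.coeff k / k.factorial) * descPochhammer ℝ k with hq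
  have hqe : ∀ n : ℕ, q.eval (n : ℝ) = binomEval n p := by
    intro n
    rw [hq, binomEval_eq_sum, eval_finsetSum]
    refine Finset.sum_congr rfl fun k _ => ?_
    rw [eval_mul, eval_C, descPochhammer_eval_eq_descFactorial,
      Nat.descFactorial_eq_factorial_mul_choose]
    push_cast
    field_simp
  have hq0 : q = 0 := by
    refine eq_zero_of_infinite_isRoot q (Set.Infinite.mono
      (s := (fun n : ℕ => (n : ℝ)) '' Set.Ici N) ?_ ?_)
    · rintro _ ⟨n, hn, rfl⟩
      exact (hqe n).trans (h n hn)
    · exact (Set.Ici_infinite N).image Nat.cast_injective.injOn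
  ext n
  rw [coeff_zero]
  induction n using Nat.strong_induction_on with
  | _ n ih =>
    have h1 := hqe n
    rw [hq0, eval_zero, binomEval_eq_sum, Finset.sum_eq_single n] at h1
    · simpa using h1.symm
    · intro k _ hk
      rcases lt_or_gt_of_ne hk with hk | hk
      · rw [ih k hk, zero_mul]
      · rw [Nat.choose_eq_zero_of_lt hk, Nat.cast_zero, mul_zero]
    · intro hn
      rw [coeff_eq_zero_of_natDegree_lt (by simpa [Nat.lt_succ_iff] using hn), zero_mul]

theorem eq_of_binomEval_eq {p q : ℝ[X]} {N : ℕ} (h : ∀ n, N ≤ n → binomEval n p = binomEval n q) :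
    p = q :=
  sub_eq_zero.1 (eq_zero_of_binomEval_eq_zero (N := N) fun n hn => by
    rw [map_sub, h n hn, sub_self])

/-! ### Tableaux -/

/-- Column-strict (reverse) plane partitions of shape `lam` with parts at most `n`, extended by
zero to all of `ℕ × ℕ`. -/
structure IsTableau (lam : ℕ → ℕ) (n : ℕ) (T : ℕ → ℕ → ℕ) : Prop where
  le : ∀ i j, T i j ≤ n
  pos_iff : ∀ i j, 0 < T i j ↔ j < lam i
  row : ∀ i j, T i (j + 1) ≤ T i j
  col : ∀ i j, 0 < T i j → T (i + 1) j < T i j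

theorem finite_ferrersPoset {lam : ℕ → ℕ} (hlam : Antitone lam) {N : ℕ} (hN : lam N = 0) :
    Finite (FerrersPoset lam) := by
  refine Set.Finite.to_subtype (s := {p : ℕ × ℕ | p.2 < lam p.1})
    (((Set.finite_Iio N).prod (Set.finite_Iio (lam 0))).subset ?_)
  rintro ⟨i, j⟩ (h : j < lam i)
  refine ⟨?_, h.trans_le (hlam (Nat.zero_le i))⟩
  by_contra hi
  have := hlam (not_lt.1 hi : N ≤ i)
  omega

theorem isPPartition_ferrers_iff {lam : ℕ → ℕ} (hlam : Antitone lam) {ω : FerrersPoset lam → ℕ}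
    (hω : ColumnStrict lam ω) {n : ℕ} (σ : FerrersPoset lam → Fin n) :
    IsPPartition ω σ ↔
      (∀ p q : FerrersPoset lam, p.val.1 = q.val.1 → p.val.2 + 1 = q.val.2 → σ q ≤ σ p) ∧
      (∀ p q : FerrersPoset lam, p.val.1 + 1 = q.val.1 → p.val.2 = q.val.2 → σ q < σ p) := by
  constructor
  · rintro ⟨h1, h2⟩
    refine ⟨fun p q h3 h4 => h1 p q ?_, fun p q h3 h4 => h2 p q ?_ (hω.2.1 p q h3 h4)⟩
    · exact (show p.val ≤ q.val from ⟨h3.le, by omega⟩)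
    · refine lt_of_le_of_ne (show p.val ≤ q.val from ⟨by omega, h4.le⟩) ?_
      rintro rfl
      omega
  · rintro ⟨hrow, hcol⟩
    have row : ∀ (d i j : ℕ) (h : j + d < lam i),
        σ ⟨(i, j + d), h⟩ ≤ σ ⟨(i, j), lt_of_le_of_lt (Nat.le_add_right j d) h⟩ := by
      intro d
      induction d with
      | zero => intro i j h; exact le_rfl
      | succ d ih =>
        intro i j h
        exact (hrow ⟨(i, j + d), lt_trans (Nat.lt_succ_self _) h⟩ ⟨(i, j + (d + 1)), h⟩ rfl
          rfl).trans (ih i j _)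
    have col : ∀ (d i j : ℕ) (h : j < lam (i + (d + 1))),
        σ ⟨(i + (d + 1), j), h⟩ < σ ⟨(i, j), h.trans_le (hlam (Nat.le_add_right i _))⟩ := by
      intro d
      induction d with
      | zero => intro i j h; exact hcol ⟨(i, j), _⟩ ⟨(i + 1, j), h⟩ rfl rfl
      | succ d ih =>
        intro i j h
        have h' : j < lam (i + (d + 1)) := h.trans_le (hlam (by omega))
        exact (hcol ⟨(i + (d + 1), j), h'⟩ ⟨(i + (d + 1 + 1), j), h⟩ rfl rfl).trans (ih i j h')
    have labels : ∀ (d i j : ℕ) (h : j + (d + 1) < lam i),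
        ω ⟨(i, j), lt_of_le_of_lt (Nat.le_add_right j _) h⟩ < ω ⟨(i, j + (d + 1)), h⟩ := by
      intro d
      induction d with
      | zero => intro i j h; exact hω.2.2 ⟨(i, j), _⟩ ⟨(i, j + 1), h⟩ rfl rfl
      | succ d ih =>
        intro i j h
        have h' : j + (d + 1) < lam i := by omega
        exact (ih i j h').trans (hω.2.2 ⟨(i, j + (d + 1)), h'⟩ ⟨(i, j + (d + 1 + 1)), h⟩ rfl rfl)
    have strict : ∀ p q : FerrersPoset lam, p ≤ q → p.val.1 < q.val.1 → σ q < σ p := by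
      rintro ⟨⟨i, j⟩, hp⟩ ⟨⟨i', j'⟩, hq⟩ hpq hlt
      obtain ⟨d, rfl⟩ := Nat.exists_eq_add_of_lt (show i < i' from hlt)
      obtain ⟨e, rfl⟩ := Nat.exists_eq_add_of_le (show j ≤ j' from hpq.2)
      exact (row e _ _ hq).trans_lt (col d i j _)
    have weak : ∀ p q : FerrersPoset lam, p ≤ q → p.val.1 = q.val.1 → σ q ≤ σ p := by
      rintro ⟨⟨i, j⟩, hp⟩ ⟨⟨i', j'⟩, hq⟩ hpq hlt
      obtain rfl : i = i' := hlt
      obtain ⟨e, rfl⟩ := Nat.exists_eq_add_of_le (show j ≤ j' from hpq.2)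
      exact row e _ _ hq
    refine ⟨fun p q hpq => ?_, fun p q hpq hl => ?_⟩
    · rcases (show p.val.1 ≤ q.val.1 from hpq.1).lt_or_eq with h | h
      · exact (strict p q hpq h).le
      · exact weak p q hpq h
    · rcases (show p.val.1 ≤ q.val.1 from hpq.le.1).lt_or_eq with h | h
      · exact strict p q hpq.le h
      · exfalso
        obtain ⟨⟨i, j⟩, hp⟩ := p
        obtain ⟨⟨i', j'⟩, hq⟩ := q
        obtain rfl : i = i' := h
        have hjj : j ≤ j' := hpq.le.2
        rcases hjj.lt_or_eq with h | rfl
        · obtain ⟨d, rfl⟩ := Nat.exists_eq_add_of_lt h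
          exact (labels d i j hq).not_gt hl
        · exact lt_irrefl _ hpq

open Classical in
theorem card_isPPartition_ferrers {lam : ℕ → ℕ} (hlam : Antitone lam) {ω : FerrersPoset lam → ℕ}
    (hω : ColumnStrict lam ω) (n : ℕ) :
    Nat.card {σ : FerrersPoset lam → Fin n // IsPPartition ω σ} =
      Nat.card {T : ℕ → ℕ → ℕ // IsTableau lam n T} := by
  refine Nat.card_congr
    { toFun := fun σ => ⟨fun i j => if h : j < lam i then (σ.1 ⟨(i, j), h⟩ : ℕ) + 1 else 0, ?_⟩
      invFun := fun T => ⟨fun p => ⟨T.1 p.val.1 p.val.2 - 1, ?_⟩, ?_⟩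
      left_inv := ?_
      right_inv := ?_ }
  · obtain ⟨σ, hσ⟩ := σ
    rw [isPPartition_ferrers_iff hlam hω] at hσ
    refine ⟨fun i j => ?_, fun i j => ?_, fun i j => ?_, fun i j => ?_⟩
    · split_ifs with h
      · exact (σ _).isLt
      · exact Nat.zero_le n
    · split_ifs with h <;> simp [h]
    · by_cases h : j + 1 < lam i
      · have h' : j < lam i := by omega
        have := Fin.le_def.1 (hσ.1 ⟨(i, j), h'⟩ ⟨(i, j + 1), h⟩ rfl rfl)
        simp only [h, h', dif_pos]
        omega
      · simp [h]
    · intro hpos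
      by_cases h : j < lam (i + 1)
      · have h' : j < lam i := h.trans_le (hlam (Nat.le_succ i))
        have := Fin.lt_def.1 (hσ.2 ⟨(i, j), h'⟩ ⟨(i + 1, j), h⟩ rfl rfl)
        simp only [h, h', dif_pos]
        omega
      · rw [dif_neg h]
        exact hpos
  · have h1 := T.2.le p.val.1 p.val.2
    have h2 := (T.2.pos_iff p.val.1 p.val.2).2 p.prop
    omega
  · rw [isPPartition_ferrers_iff hlam hω]
    constructor
    · rintro p q h1 h2
      rw [Fin.le_def]
      have := T.2.row p.val.1 p.val.2
      rw [h2, h1] at this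
      simp only [h1]
      omega
    · rintro p q h1 h2
      rw [Fin.lt_def]
      have h3 := T.2.col p.val.1 p.val.2 ((T.2.pos_iff _ _).2 p.prop)
      have h4 := (T.2.pos_iff _ _).2 q.prop
      rw [h1, h2] at h3
      simp only [h2]
      omega
  · rintro ⟨σ, hσ⟩
    refine Subtype.ext (funext fun p => Fin.ext ?_)
    have : p.val.2 < lam p.val.1 := p.prop
    simp only [this, dif_pos, Nat.add_sub_cancel]
    rfl
  · rintro ⟨T, hT⟩
    refine Subtype.ext (funext fun i => funext fun j => ?_)
    by_cases h : j < lam i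
    · have := (hT.pos_iff i j).2 h
      simp only [h, dif_pos]
      omega
    · have := (hT.pos_iff i j).not.2 h
      simp only [h, dif_neg, not_false_eq_true]
      omega

theorem finite_isTableau {lam : ℕ → ℕ} (hlam : Antitone lam) {N : ℕ} (hN : lam N = 0) (n : ℕ) :
    Finite {T : ℕ → ℕ → ℕ // IsTableau lam n T} := by
  have := finite_ferrersPoset hlam hN
  refine Finite.of_injective (β := FerrersPoset lam → Fin (n + 1))
    (fun T p => ⟨T.1 p.val.1 p.val.2, Nat.lt_succ_of_le (T.2.le _ _)⟩) ?_
  rintro ⟨T, hT⟩ ⟨T', hT'⟩ h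
  refine Subtype.ext (funext fun i => funext fun j => ?_)
  by_cases hij : j < lam i
  · exact congrArg Fin.val (congrFun h ⟨(i, j), hij⟩)
  · have h1 := (hT.pos_iff i j).not.2 hij
    have h2 := (hT'.pos_iff i j).not.2 hij
    simp only
    omega

/-- Extension of a finite sequence by zero. -/
def extendZero {n : ℕ} (m : Fin n → ℕ) (i : ℕ) : ℕ := if h : i < n then m ⟨i, h⟩ else 0

theorem extendZero_of_lt {n : ℕ} (m : Fin n → ℕ) {i : ℕ} (h : i < n) :
    extendZero m i = m ⟨i, h⟩ := dif_pos h

theorem extendZero_of_le {n : ℕ} (m : Fin n → ℕ) {i : ℕ} (h : n ≤ i) : extendZero m i = 0 :=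
  dif_neg (not_lt.2 h)

theorem antitone_extendZero {lam : ℕ → ℕ} {n : ℕ} {m : Fin n → ℕ}
    (hm : m ∈ Fintype.piFinset fun i : Fin n => Finset.Icc (lam (i + 1)) (lam i)) :
    Antitone (extendZero m) := by
  simp only [Fintype.mem_piFinset, Finset.mem_Icc] at hm
  refine antitone_nat_of_succ_le fun i => ?_
  by_cases h : i + 1 < n
  · rw [extendZero_of_lt m h, extendZero_of_lt m (by omega)]
    exact (hm ⟨i + 1, h⟩).2.trans (hm ⟨i, by omega⟩).1
  · rw [extendZero_of_le m (by omega)]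
    exact Nat.zero_le _

theorem IsTableau.add_le {lam : ℕ → ℕ} {n : ℕ} {T : ℕ → ℕ → ℕ} (hlam : Antitone lam)
    (hT : IsTableau lam n T) (i j : ℕ) (h : 0 < T i j) : T i j + i ≤ n := by
  induction i with
  | zero => exact hT.le 0 j
  | succ i ih =>
    have h1 : 0 < T i j :=
      (hT.pos_iff i j).2 (((hT.pos_iff _ j).1 h).trans_le (hlam (Nat.le_succ i)))
    have h2 := hT.col i j h1
    have := ih h1
    omega

open Classical in
theorem card_isTableau_succ {lam : ℕ → ℕ} (hlam : Antitone lam) {n : ℕ} (hn : lam (n + 1) = 0) :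
    Nat.card {T : ℕ → ℕ → ℕ // IsTableau lam (n + 1) T} =
      ∑ m ∈ Fintype.piFinset fun i : Fin n => Finset.Icc (lam (i + 1)) (lam i),
        Nat.card {T : ℕ → ℕ → ℕ // IsTableau (extendZero m) n T} := by
  set M := Fintype.piFinset fun i : Fin n => Finset.Icc (lam (i + 1)) (lam i) with hM
  have hmem : ∀ m : Fin n → ℕ, m ∈ M ↔ ∀ i : Fin n, lam (i + 1) ≤ m i ∧ m i ≤ lam i := by
    simp [hM, Fintype.mem_piFinset]
  have hlamle : ∀ i, n + 1 ≤ i → lam i = 0 := fun i hi => by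
    have := hlam hi
    omega
  have hle : ∀ m ∈ M, ∀ i, extendZero m i ≤ lam i := by
    intro m hm i
    by_cases h : i < n
    · rw [extendZero_of_lt m h]
      exact ((hmem m).1 hm ⟨i, h⟩).2
    · rw [extendZero_of_le m (not_lt.1 h)]
      exact Nat.zero_le _
  have hge : ∀ m ∈ M, ∀ i, lam (i + 1) ≤ extendZero m i := by
    intro m hm i
    by_cases h : i < n
    · rw [extendZero_of_lt m h]
      exact ((hmem m).1 hm ⟨i, h⟩).1
    · rw [hlamle (i + 1) (by omega)]
      exact Nat.zero_le _
  have : ∀ m : M, Finite {T : ℕ → ℕ → ℕ // IsTableau (extendZero m.1) n T} := fun m =>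
    finite_isTableau (antitone_extendZero m.2) (extendZero_of_le m.1 le_rfl) n
  rw [← Finset.sum_coe_sort M
    fun m => Nat.card {T : ℕ → ℕ → ℕ // IsTableau (extendZero m) n T}, ← Nat.card_sigma]
  symm
  refine Nat.card_congr (Equiv.ofBijective
    (fun x => ⟨fun i j => if j < lam i then x.2.1 i j + 1 else 0, ?_⟩) ⟨?_, ?_⟩)
  · obtain ⟨⟨m, hm⟩, T, hT⟩ := x
    replace hT : IsTableau (extendZero m) n T := hT
    refine ⟨fun i j => ?_, fun i j => ?_, fun i j => ?_, fun i j => ?_⟩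
    · have := hT.le i j
      simp only
      split_ifs <;> omega
    · simp only
      split_ifs with h <;> simp [h]
    · have := hT.row i j
      simp only
      split_ifs <;> omega
    · have h1 := hT.pos_iff i j
      have h2 := hT.col i j
      have h3 := hge m hm i
      simp only
      split_ifs <;> omega
  · rintro ⟨⟨m, hm⟩, T, hT⟩ ⟨⟨m', hm'⟩, T', hT'⟩ h
    replace hT : IsTableau (extendZero m) n T := hT
    replace hT' : IsTableau (extendZero m') n T' := hT'
    have h' : ∀ i j, (if j < lam i then T i j + 1 else 0) = if j < lam i then T' i j + 1 else 0 :=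
      fun i j => congrFun (congrFun (congrArg Subtype.val h) i) j
    obtain rfl : T = T' := by
      funext i j
      have h1 := h' i j
      have h2 := hT.pos_iff i j
      have h3 := hT'.pos_iff i j
      have h4 := hle m hm i
      have h5 := hle m' hm' i
      split_ifs at h1 <;> omega
    obtain rfl : m = m' := by
      funext i
      have h1 : ∀ j, j < m i ↔ j < m' i := by
        intro j
        have h2 := hT.pos_iff i j
        have h3 := hT'.pos_iff i j
        rw [extendZero_of_lt _ i.isLt] at h2 h3
        exact h2.symm.trans h3
      exact le_antisymm (not_lt.1 fun hlt => lt_irrefl _ ((h1 _).1 hlt))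
        (not_lt.1 fun hlt => lt_irrefl _ ((h1 _).2 hlt))
    rfl
  · rintro ⟨T, hT⟩
    have hanti : ∀ i, Antitone (T i) := fun i => antitone_nat_of_succ_le (hT.row i)
    have hzero : ∀ i j, lam i ≤ j → T i j = 0 := fun i j h => by
      have := (hT.pos_iff i j).not.2 (not_lt.2 h)
      omega
    have hex : ∀ i, ∃ j, T i j ≤ 1 := fun i => ⟨lam i, by rw [hzero i _ le_rfl]; exact zero_le_one⟩
    set f : ℕ → ℕ := fun i => Nat.find (hex i) with hf
    have hflt : ∀ i j, j < f i ↔ 2 ≤ T i j := by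
      intro i j
      constructor
      · intro h
        have := Nat.find_min (hex i) h
        omega
      · intro h
        by_contra! hc
        have h1 := hanti i hc
        have h2 : T i (f i) ≤ 1 := Nat.find_spec (hex i)
        omega
    have hfn : ∀ i, n ≤ i → f i = 0 := by
      intro i hi
      by_contra hne
      have h1 := (hflt i 0).1 (Nat.pos_of_ne_zero hne)
      have h2 := hT.add_le hlam i 0 (by omega)
      omega
    have hext : extendZero (fun i : Fin n => f i) = f := by
      funext i
      by_cases h : i < n
      · rw [extendZero_of_lt _ h]
      · rw [extendZero_of_le _ (not_lt.1 h), hfn i (not_lt.1 h)]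
    have hmM : (fun i : Fin n => f i) ∈ M := by
      rw [hmem]
      intro i
      constructor
      · by_contra! hc
        have h1 := (hT.pos_iff (i + 1) (f i)).2 hc
        have h2 := hT.col i (f i) ((hT.pos_iff _ _).2 (hc.trans_le (hlam (Nat.le_succ _))))
        have h3 := (hflt i (f i)).2 (by omega)
        omega
      · refine Nat.find_min' (hex i) ?_
        rw [hzero i _ le_rfl]
        exact zero_le_one
    refine ⟨⟨⟨_, hmM⟩, fun i j => T i j - 1, ?_⟩, ?_⟩
    · simp only [hext]
      refine ⟨fun i j => ?_, fun i j => ?_, fun i j => ?_, fun i j => ?_⟩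
      · have := hT.le i j
        omega
      · rw [hflt]
        omega
      · have := hT.row i j
        omega
      · have := hT.col i j
        omega
    · refine Subtype.ext (funext fun i => funext fun j => ?_)
      have h1 := hT.pos_iff i j
      simp only
      split_ifs <;> omega

theorem card_isTableau_zero {lam : ℕ → ℕ} (hlam : ∀ i, lam i = 0) :
    Nat.card {T : ℕ → ℕ → ℕ // IsTableau lam 0 T} = 1 := by
  rw [Nat.card_eq_one_iff_exists]
  refine ⟨⟨fun _ _ => 0, fun _ _ => le_rfl, fun i _ => by simp [hlam i], fun _ _ => le_rfl,
    fun _ _ h => h⟩, ?_⟩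
  rintro ⟨T, hT⟩
  exact Subtype.ext (funext fun i => funext fun j => Nat.le_zero.1 (hT.le i j))

/-! ### The number of tableaux as a Vandermonde determinant -/

theorem descPochhammer_eval_add_one_sub (j : ℕ) (x : ℝ) :
    (descPochhammer ℝ (j + 1)).eval (x + 1) - (descPochhammer ℝ (j + 1)).eval x =
      (j + 1) * (descPochhammer ℝ j).eval x := by
  have h := congrArg (Polynomial.eval (x + 1)) (descPochhammer_succ_comp_X_sub_one ℝ j)
  rw [eval_comp, eval_sub, eval_sub, eval_X, eval_one, add_sub_cancel_right] at h
  rw [h, sub_sub_cancel]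
  simp [eval_comp]

theorem sum_Icc_descPochhammer_eval (j : ℕ) (x : ℝ) {a b : ℕ} (hab : a ≤ b) :
    ∑ k ∈ Finset.Icc a b, (descPochhammer ℝ j).eval (k - x) =
      ((j : ℝ) + 1)⁻¹ * ((descPochhammer ℝ (j + 1)).eval (b - x + 1) -
        (descPochhammer ℝ (j + 1)).eval (a - x)) := by
  have h := Finset.sum_Ico_sub (fun k : ℕ => (descPochhammer ℝ (j + 1)).eval (k - x))
    (hab.trans (Nat.le_succ b))
  rw [show ((b.succ : ℕ) : ℝ) - x = b - x + 1 by push_cast; ring] at h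
  rw [← h, Finset.mul_sum]
  refine Finset.sum_congr (by ext; simp) fun k _ => ?_
  rw [show ((k + 1 : ℕ) : ℝ) - x = k - x + 1 by push_cast; ring,
    descPochhammer_eval_add_one_sub, inv_mul_cancel_left₀ (by positivity)]

theorem det_vandermonde_eq_det_descPochhammer {n : ℕ} (v : Fin n → ℝ) :
    (Matrix.vandermonde v).det =
      (Matrix.of fun i j : Fin n => (descPochhammer ℝ j).eval (v i)).det :=
  Matrix.det_eval_matrixOfPolynomials_eq_det_vandermonde v (fun j => descPochhammer ℝ j)
    (fun j => descPochhammer_natDegree ℝ j) fun j => monic_descPochhammer ℝ j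

theorem det_descPochhammer_sub {n : ℕ} (u : Fin (n + 1) → ℝ) :
    (Matrix.of fun i j : Fin n => (descPochhammer ℝ (j + 1)).eval (u i.castSucc) -
      (descPochhammer ℝ (j + 1)).eval (u i.succ)).det =
      (-1) ^ n * (Matrix.vandermonde u).det := by
  set A : Matrix (Fin (n + 1)) (Fin (n + 1)) ℝ :=
    Matrix.of fun i j => (descPochhammer ℝ j).eval (u i) with hA
  set B : Matrix (Fin (n + 1)) (Fin (n + 1)) ℝ :=
    Matrix.of (Fin.cons (A 0) fun i j => A i.succ j - A i.castSucc j) with hB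
  have hAB : A.det = B.det :=
    Matrix.det_eq_of_forall_row_eq_smul_add_pred (fun _ => 1) (fun j => by simp [hB])
      fun i j => by simp [hB]
  have hBdet : B.det = (B.submatrix Fin.succ Fin.succ).det := by
    rw [Matrix.det_succ_column_zero, Fin.sum_univ_succ, Finset.sum_eq_zero, add_zero]
    · simp [hB, hA, Fin.succAbove_zero]
    · intro i _
      simp [hB, hA]
  rw [det_vandermonde_eq_det_descPochhammer, ← hA, hAB, hBdet]
  have : B.submatrix Fin.succ Fin.succ =
      -(Matrix.of fun i j : Fin n => (descPochhammer ℝ (j + 1)).eval (u i.castSucc) -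
      (descPochhammer ℝ (j + 1)).eval (u i.succ)) := by
    ext i j
    simp [hB, hA]
  rw [this, Matrix.det_neg, Fintype.card_fin, ← mul_assoc, ← mul_pow]
  simp

theorem sum_det_vandermonde {lam : ℕ → ℕ} (hlam : Antitone lam) (n : ℕ) :
    ∑ m ∈ Fintype.piFinset fun i : Fin n => Finset.Icc (lam (i + 1)) (lam i),
        (Matrix.vandermonde fun i : Fin n => (m i : ℝ) - i).det =
      ((∏ j : Fin n, ((j : ℝ) + 1)⁻¹) * (-1) ^ n) *
        (Matrix.vandermonde fun i : Fin (n + 1) => (lam i : ℝ) - i).det := by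
  have h := MultilinearMap.map_sum_finset
    (Matrix.detRowAlternating (n := Fin n) (R := ℝ)).toMultilinearMap
    (fun (i : Fin n) (k : ℕ) (j : Fin n) => (descPochhammer ℝ j).eval ((k : ℝ) - i))
    (fun i : Fin n => Finset.Icc (lam (i + 1)) (lam i))
  simp only [det_vandermonde_eq_det_descPochhammer (n := n)]
  refine h.symm.trans ?_
  rw [mul_assoc, ← Matrix.det_vandermonde_add _ 1, ← det_descPochhammer_sub, ← Matrix.det_mul_row]
  refine congrArg Matrix.det ?_
  ext i j
  rw [Finset.sum_apply, sum_Icc_descPochhammer_eval _ _ (hlam (Nat.le_succ i))]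
  simp only [Matrix.of_apply, Fin.val_castSucc, Fin.val_succ]
  congr 4
  push_cast
  ring

/-- The number of tableaux with parts at most `n` is a Vandermonde determinant in the shifted row
lengths, up to a factor that does not depend on the shape. -/
theorem exists_card_isTableau_eq_mul_det (n : ℕ) :
    ∃ κ : ℝ, ∀ lam : ℕ → ℕ, Antitone lam → lam n = 0 →
      (Nat.card {T : ℕ → ℕ → ℕ // IsTableau lam n T} : ℝ) =
        κ * (Matrix.vandermonde fun i : Fin n => (lam i : ℝ) - i).det := by
  induction n with
  | zero =>
    refine ⟨1, fun lam hlam h0 => ?_⟩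
    rw [card_isTableau_zero fun i => Nat.le_zero.1 (h0 ▸ hlam (Nat.zero_le i))]
    simp
  | succ n ih =>
    obtain ⟨κ, hκ⟩ := ih
    refine ⟨κ * ((∏ j : Fin n, ((j : ℝ) + 1)⁻¹) * (-1) ^ n), fun lam hlam hn => ?_⟩
    rw [card_isTableau_succ hlam hn, Nat.cast_sum, mul_assoc, ← sum_det_vandermonde hlam,
      Finset.mul_sum]
    refine Finset.sum_congr rfl fun m hm => ?_
    rw [hκ _ (antitone_extendZero hm) (extendZero_of_le m le_rfl)]
    simp only [extendZero_of_lt m (Fin.isLt _)]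

/-! ### Removing a corner -/

theorem det_vandermonde_succ (v : ℕ → ℝ) (n : ℕ) :
    (Matrix.vandermonde fun i : Fin (n + 1) => v i).det =
      (Matrix.vandermonde fun i : Fin n => v i).det * ∏ i : Fin n, (v n - v i) := by
  have h : ∀ m : ℕ, (Matrix.vandermonde fun i : Fin m => v i).det =
      ∏ i : Fin m, ∏ j : Fin m, if i < j then v j - v i else 1 := by
    intro m
    rw [Matrix.det_vandermonde]
    refine Finset.prod_congr rfl fun i _ => ?_
    rw [← Finset.prod_filter]
    refine Finset.prod_congr (by ext; simp) fun _ _ => rfl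
  rw [h, h, ← Finset.prod_mul_distrib]
  have hlast : ∀ x : Fin n, ¬ Fin.last n < x.castSucc := fun x => not_lt.2 (Fin.le_last _)
  simp [Fin.prod_univ_castSucc, Fin.castSucc_lt_last, hlast]

theorem det_vandermonde_ne_zero_of_strictAnti {v : ℕ → ℝ} (hv : StrictAnti v) (n : ℕ) :
    (Matrix.vandermonde fun i : Fin n => v i).det ≠ 0 :=
  Matrix.det_vandermonde_ne_zero_iff.2 fun _ _ h => Fin.ext (hv.injective h)

/-- Lowering a single node by one multiplies the Vandermonde determinants of an eventually
equispaced sequence by a linear function of their size, up to a constant. -/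
theorem det_vandermonde_ratio {v w : ℕ → ℝ} {r N : ℕ} (hrN : r < N)
    (hvw : ∀ i, i ≠ r → v i = w i) (hr : v r = w r + 1) (hN : ∀ i, N ≤ i → w i = -i)
    (hpos : 0 < N + w r) {n : ℕ} (hn : N ≤ n) :
    (Matrix.vandermonde fun i : Fin n => v i).det *
        ((N + w r) * (Matrix.vandermonde fun i : Fin N => w i).det) =
      (Matrix.vandermonde fun i : Fin N => v i).det *
        ((n + w r) * (Matrix.vandermonde fun i : Fin n => w i).det) := by
  induction n, hn using Nat.le_induction with
  | base => rfl
  | succ n hn ih =>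
    have hn' : (N : ℝ) ≤ n := by exact_mod_cast hn
    have hprod : (∏ i : Fin n, (v n - v i)) * (n + w r) =
        (∏ i : Fin n, (w n - w i)) * ((n + 1 : ℕ) + w r) := by
      have hrn : r < n := hrN.trans_le hn
      have h1 : ∀ u : ℕ → ℝ, ∏ i : Fin n, (u n - u i) =
          (u n - u r) * ∏ i ∈ Finset.univ.erase (⟨r, hrn⟩ : Fin n), (u n - u i) := fun u =>
        (Finset.mul_prod_erase Finset.univ (fun i : Fin n => u n - u i)
          (Finset.mem_univ ⟨r, hrn⟩)).symm
      rw [h1 v, h1 w, hvw n hrn.ne', hr, hN n hn]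
      have h2 : ∏ i ∈ Finset.univ.erase (⟨r, hrn⟩ : Fin n), (-(n : ℝ) - v i) =
          ∏ i ∈ Finset.univ.erase (⟨r, hrn⟩ : Fin n), (-(n : ℝ) - w i) := by
        refine Finset.prod_congr rfl fun i hi => ?_
        rw [hvw i fun h => (Finset.mem_erase.1 hi).1 (Fin.ext h)]
      rw [h2]
      push_cast
      ring
    rw [det_vandermonde_succ, det_vandermonde_succ]
    refine mul_right_cancel₀ (b := (n : ℝ) + w r) (by linarith) ?_
    linear_combination
      (∏ i : Fin n, (v n - v i)) * (n + w r) * ih +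
      (Matrix.vandermonde fun i : Fin N => v i).det * (n + w r) *
        (Matrix.vandermonde fun i : Fin n => w i).det * hprod

theorem strictAnti_sub_natCast {lam : ℕ → ℕ} (hlam : Antitone lam) :
    StrictAnti fun i => (lam i : ℝ) - i := by
  refine strictAnti_nat_of_succ_lt fun i => ?_
  have : (lam (i + 1) : ℝ) ≤ lam i := by exact_mod_cast hlam (Nat.le_succ i)
  push_cast
  linarith

theorem exists_Epoly_eq_contentOp {lam mu : ℕ → ℕ} (hlam : Antitone lam) (hmu : Antitone mu)
    (hfin : ∃ N, lam N = 0) {r : ℕ} (hr : lam r = mu r + 1) (hne : ∀ i, i ≠ r → mu i = lam i)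
    {ω : FerrersPoset lam → ℕ} (hω : ColumnStrict lam ω)
    {ω' : FerrersPoset mu → ℕ} (hω' : ColumnStrict mu ω') :
    ∃ K : ℝ, K ≠ 0 ∧ Epoly (FerrersPoset lam) ω =
      C K * contentOp ((mu r : ℝ) - r) (Epoly (FerrersPoset mu) ω') := by
  obtain ⟨N, hN⟩ := hfin
  have hrN : r < N := by
    by_contra! h
    have := hlam h
    omega
  have hlamN : ∀ i, N ≤ i → lam i = 0 := fun i hi => by
    have := hlam hi
    omega
  have hmuN : ∀ i, N ≤ i → mu i = 0 := fun i hi => by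
    rw [hne i (by omega), hlamN i hi]
  have := finite_ferrersPoset hlam hN
  have := finite_ferrersPoset hmu (hmuN N le_rfl)
  have hpos : (0 : ℝ) < N + ((mu r : ℝ) - r) := by
    have h1 : (r : ℝ) < N := by exact_mod_cast hrN
    have h2 : (0 : ℝ) ≤ mu r := Nat.cast_nonneg _
    linarith
  have hv0 := det_vandermonde_ne_zero_of_strictAnti (strictAnti_sub_natCast hlam) N
  have hw0 := det_vandermonde_ne_zero_of_strictAnti (strictAnti_sub_natCast hmu) N
  set V := (Matrix.vandermonde fun i : Fin N => (lam i : ℝ) - i).det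
  set W := (Matrix.vandermonde fun i : Fin N => (mu i : ℝ) - i).det
  refine ⟨V / ((N + ((mu r : ℝ) - r)) * W), div_ne_zero hv0 (mul_ne_zero hpos.ne' hw0),
    eq_of_binomEval_eq (N := N) fun n hn => ?_⟩
  rw [← smul_eq_C_mul, map_smul, binomEval_contentOp, binomEval_Epoly, binomEval_Epoly,
    card_isPPartition_ferrers hlam hω, card_isPPartition_ferrers hmu hω']
  obtain ⟨κ, hκ⟩ := exists_card_isTableau_eq_mul_det n
  rw [hκ lam hlam (hlamN n hn), hκ mu hmu (hmuN n hn), smul_eq_mul, div_mul_eq_mul_div,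
    eq_div_iff (mul_ne_zero hpos.ne' hw0)]
  have key := det_vandermonde_ratio (v := fun i => (lam i : ℝ) - i)
    (w := fun i => (mu i : ℝ) - i) hrN (fun i hi => by simp only [hne i hi])
    (by simp only [hr]; push_cast; ring) (fun i hi => by simp [hmuN i hi]) hpos hn
  linear_combination κ * key

/-! ### Induction on the shape -/

theorem ColumnStrict.restrict {lam mu : ℕ → ℕ} {ω : FerrersPoset lam → ℕ}
    (hω : ColumnStrict lam ω) (hle : ∀ i, mu i ≤ lam i) :
    ColumnStrict mu (fun p => ω ⟨p.val, lt_of_lt_of_le p.prop (hle p.val.1)⟩) :=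
  ⟨fun _ _ h => Subtype.ext (congrArg Subtype.val (hω.1 h) :), fun _ _ h1 h2 => hω.2.1 _ _ h1 h2,
    fun _ _ h1 h2 => hω.2.2 _ _ h1 h2⟩

/-- The properties of `E`-polynomials of column-strict Ferrers posets which are preserved when a
cell is added to the shape. -/
structure FerrersRootBounds (lam : ℕ → ℕ) (p : ℝ[X]) : Prop where
  ne_zero : p ≠ 0
  splits : p.Splits
  roots_mem : ∀ r ∈ p.roots, -1 ≤ r ∧ r ≤ 0
  X_pow_dvd : ∀ i, 0 < lam i → X ^ (i + 1) ∣ p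
  X_add_one_pow_dvd : (X + 1) ^ (lam 0 - 1) ∣ p

theorem FerrersRootBounds.contentOp {lam mu : ℕ → ℕ} (hlam : Antitone lam) (hmu : Antitone mu)
    {r : ℕ} (hr : lam r = mu r + 1) (hne : ∀ i, i ≠ r → mu i = lam i) {p : ℝ[X]}
    (hp : FerrersRootBounds mu p) {K : ℝ} (hK : K ≠ 0) :
    FerrersRootBounds lam (C K * _root_.contentOp ((mu r : ℝ) - r) p) := by
  obtain ⟨hs, h0, -, -⟩ := contentOp_interlace hp.splits hp.ne_zero hp.roots_mem ((mu r : ℝ) - r)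
  have hX : X ^ r ∣ p := by
    rcases Nat.eq_zero_or_pos r with rfl | hpos
    · simp
    · have h1 := hlam (Nat.sub_le r 1)
      have h2 := hp.X_pow_dvd (r - 1) (by rw [hne _ (by omega)]; omega)
      rwa [Nat.sub_add_cancel hpos] at h2
  refine ⟨mul_ne_zero (C_ne_zero.2 hK) h0, (Splits.C K).mul hs, fun x hx => ?_, fun i hi => ?_, ?_⟩
  · rw [roots_C_mul _ hK] at hx
    constructor
    · refine neg_one_le_roots_contentOp hp.splits hp.ne_zero (fun y hy => (hp.roots_mem y hy).1)
        hp.X_add_one_pow_dvd ?_ x hx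
      have h1 : mu r ≤ mu 0 - 1 + 1 + r := by
        have := hmu (Nat.zero_le r)
        omega
      have h2 : (mu r : ℝ) ≤ (mu 0 - 1 : ℕ) + 1 + r := by exact_mod_cast h1
      linarith
    · refine roots_contentOp_nonpos hp.splits hp.ne_zero (fun y hy => (hp.roots_mem y hy).2)
        hX ?_ x hx
      have : (0 : ℝ) ≤ mu r := Nat.cast_nonneg _
      linarith
  · refine Dvd.dvd.mul_left ?_ _
    by_cases hi0 : 0 < mu i
    · exact X_pow_dvd_contentOp _ (hp.X_pow_dvd i hi0)
    · obtain rfl : i = r := by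
        by_contra h
        exact hi0 (hne i h ▸ hi)
      rw [show (mu i : ℝ) - i = -i by rw [Nat.eq_zero_of_not_pos hi0]; simp]
      exact X_pow_succ_dvd_contentOp hX
  · refine Dvd.dvd.mul_left ?_ _
    by_cases hr0 : r = 0
    · subst hr0
      rcases Nat.eq_zero_or_pos (mu 0) with h | h
      · simp [hr, h]
      · obtain ⟨b, hb⟩ := Nat.exists_eq_add_of_lt h
        have h1 := hp.X_add_one_pow_dvd
        rw [hb] at h1
        have h2 := X_add_one_pow_succ_dvd_contentOp h1
        rw [hr, hb]
        convert h2 using 2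
        · omega
        · push_cast
          ring
    · rw [← hne 0 (Ne.symm hr0)]
      exact X_add_one_pow_dvd_contentOp _ hp.X_add_one_pow_dvd

theorem Epoly_eq_one_of_isEmpty {α : Type*} [PartialOrder α] [IsEmpty α] (ω : α → ℕ) :
    Epoly α ω = 1 := by
  have : Nat.card {σ : α → Fin 0 // Function.Surjective σ ∧ IsPPartition ω σ} = 1 := by
    rw [Nat.card_eq_one_iff_exists]
    exact ⟨⟨isEmptyElim, fun x => x.elim0, isEmptyElim, isEmptyElim⟩,
      fun σ => Subtype.ext (Subsingleton.elim _ _)⟩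
  simp [Epoly, this]

theorem ferrersRootBounds_Epoly {lam : ℕ → ℕ} (hlam : Antitone lam) {N : ℕ} (hN : lam N = 0)
    {ω : FerrersPoset lam → ℕ} (hω : ColumnStrict lam ω) :
    FerrersRootBounds lam (Epoly (FerrersPoset lam) ω) := by
  induction hs : ∑ i ∈ Finset.range N, lam i using Nat.strong_induction_on generalizing lam with
  | _ s ih =>
  subst hs
  by_cases h0 : lam 0 = 0
  · have hzero : ∀ i, lam i = 0 := fun i => Nat.le_zero.1 (h0 ▸ hlam (Nat.zero_le i))
    have : IsEmpty (FerrersPoset lam) := ⟨fun p => by simpa [hzero] using p.prop⟩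
    rw [Epoly_eq_one_of_isEmpty]
    exact ⟨one_ne_zero, Splits.one, by simp, by simp [hzero], by simp [hzero]⟩
  · obtain ⟨r, hr, hr'⟩ : ∃ r, lam r ≠ 0 ∧ lam (r + 1) = 0 := by
      by_contra! h
      exact (Nat.rec h0 h N : lam N ≠ 0) hN
    set mu := Function.update lam r (lam r - 1) with hmu_def
    have hmur : lam r = mu r + 1 := by
      rw [hmu_def, Function.update_self]
      omega
    have hne : ∀ i, i ≠ r → mu i = lam i := fun i hi => Function.update_of_ne hi _ _
    have hle : ∀ i, mu i ≤ lam i := fun i => by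
      rcases eq_or_ne i r with rfl | hi
      · omega
      · exact (hne i hi).le
    have hmu : Antitone mu := antitone_nat_of_succ_le fun i => by
      rcases eq_or_ne i r with rfl | hi
      · rw [hne _ (Nat.succ_ne_self i), hr']
        exact Nat.zero_le _
      · rw [hne i hi]
        exact (hle _).trans (hlam (Nat.le_succ i))
    have hrN : r < N := by
      by_contra! h
      have := hlam h
      omega
    obtain ⟨K, hK, hE⟩ := exists_Epoly_eq_contentOp hlam hmu ⟨N, hN⟩ hmur hne hω
      (hω.restrict hle)
    rw [hE]
    refine (ih _ ?_ hmu ?_ (hω.restrict hle) rfl).contentOp hlam hmu hmur hne hK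
    · exact Finset.sum_lt_sum (fun i _ => hle i) ⟨r, Finset.mem_range.2 hrN, by omega⟩
    · rw [hne N hrN.ne', hN]

theorem card_ferrersPoset {lam : ℕ → ℕ} {N : ℕ} (hN : ∀ i, N ≤ i → lam i = 0) :
    Nat.card (FerrersPoset lam) = ∑ i ∈ Finset.range N, lam i := by
  have e : FerrersPoset lam ≃ Σ i : Fin N, Fin (lam i) :=
    { toFun := fun p => ⟨⟨p.val.1, not_le.1 fun h =>
        absurd (hN _ h ▸ p.prop) (Nat.not_lt_zero _)⟩, ⟨p.val.2, p.prop⟩⟩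
      invFun := fun x => ⟨(x.1, x.2), x.2.isLt⟩
      left_inv := fun _ => rfl
      right_inv := fun _ => rfl }
  rw [Nat.card_congr e, Nat.card_sigma, Finset.sum_range]
  simp

theorem exists_eq_add_one_of_sum_add_one_eq {ι : Type*} [DecidableEq ι] {s : Finset ι}
    {f g : ι → ℕ} (hle : ∀ i ∈ s, g i ≤ f i) (h : ∑ i ∈ s, g i + 1 = ∑ i ∈ s, f i) :
    ∃ r ∈ s, f r = g r + 1 ∧ ∀ i ∈ s, i ≠ r → g i = f i := by
  obtain ⟨r, hr, hlt⟩ : ∃ r ∈ s, g r < f r :=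
    Finset.exists_lt_of_sum_lt (by omega)
  have hle' : ∀ i ∈ s.erase r, g i ≤ f i := fun i hi => hle i (Finset.mem_of_mem_erase hi)
  have h1 := Finset.add_sum_erase s f hr
  have h2 := Finset.add_sum_erase s g hr
  have h3 := Finset.sum_le_sum hle'
  exact ⟨r, hr, by omega, fun i hi hir =>
    (Finset.sum_eq_sum_iff_of_le hle').1 (by omega) i (Finset.mem_erase.2 ⟨hir, hi⟩)⟩

/-- **Theorem 3.5.** If `ω` is a column-strict labelling of the Ferrers poset `P_λ`, then
`E(P_λ, ω)` is real-rooted; and if `λ` covers `μ` in Young's lattice (i.e. `μ ≤ λ` pointwise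
and `P_μ` has exactly one cell fewer than `P_λ`), then `E(P_μ, ω) ⪯ E(P_λ, ω)`, where the
labelling of `P_μ` is the restriction of `ω`. -/
theorem ferrers_Epoly_real_rooted_and_interlacing
    (lam : ℕ → ℕ) (hlam : Antitone lam) (hfin : ∃ N, lam N = 0)
    (ω : FerrersPoset lam → ℕ) (hω : ColumnStrict lam ω) :
    RealRooted (Epoly (FerrersPoset lam) ω) ∧
    ∀ (mu : ℕ → ℕ), Antitone mu → ∀ (hle : ∀ i, mu i ≤ lam i),
      Nat.card (FerrersPoset mu) + 1 = Nat.card (FerrersPoset lam) →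
      Interlaces
        (Epoly (FerrersPoset mu)
          (fun p => ω ⟨p.val, lt_of_lt_of_le p.prop (hle p.val.1)⟩))
        (Epoly (FerrersPoset lam) ω) := by
  obtain ⟨N, hN⟩ := hfin
  have hE := ferrersRootBounds_Epoly hlam hN hω
  refine ⟨RealRooted.of_splits hE.splits hE.ne_zero, fun mu hmu hle hcard => ?_⟩
  have hlamN : ∀ i, N ≤ i → lam i = 0 := fun i hi => Nat.le_zero.1 (hN ▸ hlam hi)
  have hmuN : ∀ i, N ≤ i → mu i = 0 := fun i hi => Nat.le_zero.1 (hlamN i hi ▸ hle i)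
  rw [card_ferrersPoset hlamN, card_ferrersPoset hmuN] at hcard
  obtain ⟨r, -, hr, hne⟩ := exists_eq_add_one_of_sum_add_one_eq (fun i _ => hle i) hcard
  have hne' : ∀ i, i ≠ r → mu i = lam i := fun i hi => by
    rcases lt_or_ge i N with h | h
    · exact hne i (Finset.mem_range.2 h) hi
    · rw [hlamN i h, hmuN i h]
  have hE' := ferrersRootBounds_Epoly hmu (hmuN N le_rfl) (hω.restrict hle)
  obtain ⟨K, hK, hEE⟩ := exists_Epoly_eq_contentOp hlam hmu ⟨N, hN⟩ hr hne' hω (hω.restrict hle)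
  obtain ⟨-, -, hdeg, hint⟩ :=
    contentOp_interlace hE'.splits hE'.ne_zero hE'.roots_mem ((mu r : ℝ) - r)
  refine interlaces_of_countInterlace hE.splits hE'.splits hE.ne_zero hE'.ne_zero ?_ ?_
  · rw [hEE, natDegree_C_mul hK, hdeg]
  · rw [hEE, roots_C_mul _ hK]
    exact hint
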